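/- arXiv:1203.6561 — 3 statements merged into one kernel-verified Lean document; each statement's English description precedes it below -/
import Mathlib

section
/- At most one tight pair. Let ⟨G,m⟩ be a gain graph such that |E| = 2|V| − 2, every subgraph (V',E') with V' nonempty satisfies |E'| ≤ 2|V'| − 2, and m is constructive; let v₀ be a 3-valent vertex with pairwise distinct neighbours v₁, v₂, v₃ and gains m₀₁, m₀₂, m₀₃. Then no subgraph (V',E') with |E'| = 2|V'| − 2 and v₀ ∉ V' contains all three of v₁, v₂, v₃, and there do not exist subgraphs (V₁',E₁') and (V₂',E₂'), each satisfying |E'| = 2|V'| − 2 and v₀ ∉ V', such that V₁' contains one two-element subset of {v₁, v₂, v₃} and V₂' contains a different two-element subset of {v₁, v₂, v₃}. In other words, at most one two-element subset of {v₁, v₂, v₃} is contained in the vertex set of a subgraph with |E'| = 2|V'| − 2 avoiding v₀. -/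
open Finset

namespace PeriodicRigidity

/-- Cast an integer gain vector to a vector of `ℝ × ℝ`. -/
def zcast (z : ℤ × ℤ) : ℝ × ℝ := ((z.1 : ℝ), (z.2 : ℝ))

variable {V E : Type*}

/-- The rigidity row of the edge `e` of the gain graph `(t, h, m)` at the realization `p`:
its value at a vertex `v` is `d_e` if `v = t e ≠ h e`, `-d_e` if `v = h e ≠ t e`, and `0`
otherwise, where `d_e = p (t e) - p (h e) - m e`. -/
def row [DecidableEq V] (t h : E → V) (m : E → ℤ × ℤ) (p : V → ℝ × ℝ) (e : E) :
    V → ℝ × ℝ := fun v =>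
  if t e = h e then 0
  else if v = t e then p (t e) - p (h e) - zcast (m e)
  else if v = h e then -(p (t e) - p (h e) - zcast (m e))
  else 0

/-- The edges of the framework `((t, h, m), p)` are independent. -/
def Indep [DecidableEq V] (t h : E → V) (m : E → ℤ × ℤ) (p : V → ℝ × ℝ) : Prop :=
  LinearIndependent ℝ (row t h m p)

/-- `(V', E')` is a subgraph of the gain graph with tail map `t` and head map `h`. -/
def IsSubgraph (t h : E → V) (V' : Finset V) (E' : Finset E) : Prop :=
  ∀ e ∈ E', t e ∈ V' ∧ h e ∈ V'

/-- A set of edges is balanced if the gains are given by a potential on the vertices. -/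
def Balanced (t h : E → V) (m : E → ℤ × ℤ) (E' : Finset E) : Prop :=
  ∃ φ : V → ℤ × ℤ, ∀ e ∈ E', m e = φ (h e) - φ (t e)

/-- The gain assignment `m` is constructive: no subgraph `(V', E')` with `|V'| ≥ 2` and
`|E'| = 2 |V'| - 2` is balanced. -/
def Constructive (t h : E → V) (m : E → ℤ × ℤ) : Prop :=
  ∀ (V' : Finset V) (E' : Finset E), IsSubgraph t h V' E' → 2 ≤ V'.card →
    (E'.card : ℤ) = 2 * V'.card - 2 → ¬ Balanced t h m E'

/-- Relative version of `Constructive`, for the graph `(VS, ES)` inside an ambient graph. -/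
def ConstructiveOn (t h : E → V) (m : E → ℤ × ℤ) (VS : Finset V) (ES : Finset E) : Prop :=
  ∀ (V' : Finset V) (E' : Finset E), V' ⊆ VS → E' ⊆ ES → IsSubgraph t h V' E' →
    2 ≤ V'.card → (E'.card : ℤ) = 2 * V'.card - 2 → ¬ Balanced t h m E'

/-- The edge `e` is, up to reversal, an edge from `u` to `v` with gain `g`. -/
def EdgeIs (t h : E → V) (m : E → ℤ × ℤ) (e : E) (u v : V) (g : ℤ × ℤ) : Prop :=
  (t e = u ∧ h e = v ∧ m e = g) ∨ (t e = v ∧ h e = u ∧ m e = -g)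

/-- If every subgraph is `(2, 2)`-sparse, then the union of two tight subgraphs sharing a vertex
has at least `2 |V'| - 2` edges. -/
theorem two_mul_card_union_sub_two_le [DecidableEq V] [DecidableEq E] {t h : E → V}
    (hsub : ∀ (V' : Finset V) (E' : Finset E), IsSubgraph t h V' E' → V'.Nonempty →
      (E'.card : ℤ) ≤ 2 * V'.card - 2)
    {V₁ V₂ : Finset V} {E₁ E₂ : Finset E} (h₁ : IsSubgraph t h V₁ E₁)
    (h₂ : IsSubgraph t h V₂ E₂) (hc₁ : (E₁.card : ℤ) = 2 * V₁.card - 2)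
    (hc₂ : (E₂.card : ℤ) = 2 * V₂.card - 2) (hne : (V₁ ∩ V₂).Nonempty) :
    2 * ((V₁ ∪ V₂).card : ℤ) - 2 ≤ (E₁ ∪ E₂).card := by
  have hinter : IsSubgraph t h (V₁ ∩ V₂) (E₁ ∩ E₂) := fun e he => by
    rw [mem_inter] at he
    exact ⟨mem_inter.2 ⟨(h₁ e he.1).1, (h₂ e he.2).1⟩, mem_inter.2 ⟨(h₁ e he.1).2, (h₂ e he.2).2⟩⟩
  have hle := hsub _ _ hinter hne
  have hV := card_union_add_card_inter V₁ V₂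
  have hE := card_union_add_card_inter E₁ E₂
  omega

theorem IsSubgraph.union [DecidableEq V] [DecidableEq E] {t h : E → V} {V₁ V₂ : Finset V}
    {E₁ E₂ : Finset E} (h₁ : IsSubgraph t h V₁ E₁) (h₂ : IsSubgraph t h V₂ E₂) :
    IsSubgraph t h (V₁ ∪ V₂) (E₁ ∪ E₂) := fun e he => by
  rcases mem_union.1 he with he | he
  · exact ⟨mem_union_left _ (h₁ e he).1, mem_union_left _ (h₁ e he).2⟩
  · exact ⟨mem_union_right _ (h₂ e he).1, mem_union_right _ (h₂ e he).2⟩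

theorem EdgeIs.endpoints_mem {t h : E → V} {m : E → ℤ × ℤ} {e : E} {u v : V} {g : ℤ × ℤ}
    (he : EdgeIs t h m e u v g) {W : Finset V} (hu : u ∈ W) (hv : v ∈ W) :
    t e ∈ W ∧ h e ∈ W := by
  rcases he with ⟨ht, hh, -⟩ | ⟨ht, hh, -⟩ <;> simp [ht, hh, hu, hv]

theorem EdgeIs.notMem {t h : E → V} {m : E → ℤ × ℤ} {e : E} {u v : V} {g : ℤ × ℤ}
    (he : EdgeIs t h m e u v g) {W : Finset V} {F : Finset E} (hF : IsSubgraph t h W F)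
    (hu : u ∉ W) : e ∉ F := fun hmem => by
  rcases he with ⟨ht, -, -⟩ | ⟨-, hh, -⟩
  · exact hu (ht ▸ (hF e hmem).1)
  · exact hu (hh ▸ (hF e hmem).2)

/-- **At most one tight pair.** In a gain graph with `|E| = 2 |V| - 2`, all subgraphs
satisfying `|E'| ≤ 2 |V'| - 2` and `m` constructive, let `v₀` be a 3-valent vertex with
pairwise distinct neighbours `v₁, v₂, v₃`. Then no tight subgraph (`|E'| = 2 |V'| - 2`)
avoiding `v₀` contains all three of `v₁, v₂, v₃`, and no two tight subgraphs avoiding `v₀`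
contain two different two-element subsets of `{v₁, v₂, v₃}`. -/
theorem at_most_one_tight_pair {V E : Type*} [Fintype V] [Fintype E] [DecidableEq V]
    [DecidableEq E]
    (t h : E → V) (m : E → ℤ × ℤ)
    (hE : (Fintype.card E : ℤ) = 2 * Fintype.card V - 2)
    (hsub : ∀ (V' : Finset V) (E' : Finset E), IsSubgraph t h V' E' → V'.Nonempty →
        (E'.card : ℤ) ≤ 2 * V'.card - 2)
    (hcon : Constructive t h m)
    (v₀ v₁ v₂ v₃ : V) (m₀₁ m₀₂ m₀₃ : ℤ × ℤ) (e₁ e₂ e₃ : E)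
    (he12 : e₁ ≠ e₂) (he13 : e₁ ≠ e₃) (he23 : e₂ ≠ e₃)
    (hv10 : v₁ ≠ v₀) (hv20 : v₂ ≠ v₀) (hv30 : v₃ ≠ v₀)
    (hv12 : v₁ ≠ v₂) (hv23 : v₂ ≠ v₃) (hv13 : v₁ ≠ v₃)
    (hE1 : EdgeIs t h m e₁ v₀ v₁ m₀₁)
    (hE2 : EdgeIs t h m e₂ v₀ v₂ m₀₂)
    (hE3 : EdgeIs t h m e₃ v₀ v₃ m₀₃)
    (hval : ∀ e : E, t e = v₀ ∨ h e = v₀ → e = e₁ ∨ e = e₂ ∨ e = e₃) :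
    (∀ (V' : Finset V) (E' : Finset E), IsSubgraph t h V' E' →
        (E'.card : ℤ) = 2 * V'.card - 2 → v₀ ∉ V' →
        ¬ (v₁ ∈ V' ∧ v₂ ∈ V' ∧ v₃ ∈ V')) ∧
    ¬ ∃ (V₁' V₂' : Finset V) (E₁' E₂' : Finset E),
        IsSubgraph t h V₁' E₁' ∧ (E₁'.card : ℤ) = 2 * V₁'.card - 2 ∧ v₀ ∉ V₁' ∧
        IsSubgraph t h V₂' E₂' ∧ (E₂'.card : ℤ) = 2 * V₂'.card - 2 ∧ v₀ ∉ V₂' ∧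
        ((v₁ ∈ V₁' ∧ v₂ ∈ V₁' ∧ v₂ ∈ V₂' ∧ v₃ ∈ V₂') ∨
          (v₁ ∈ V₁' ∧ v₂ ∈ V₁' ∧ v₃ ∈ V₂' ∧ v₁ ∈ V₂') ∨
          (v₂ ∈ V₁' ∧ v₃ ∈ V₁' ∧ v₃ ∈ V₂' ∧ v₁ ∈ V₂')) := by
  have hthree : ∀ (W : Finset V) (F : Finset E), IsSubgraph t h W F →
      2 * (W.card : ℤ) - 2 ≤ F.card → v₀ ∉ W → ¬ (v₁ ∈ W ∧ v₂ ∈ W ∧ v₃ ∈ W) := by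
    rintro W F hF hc h₀ ⟨h₁, h₂, h₃⟩
    have hext : IsSubgraph t h (insert v₀ W) (insert e₁ (insert e₂ (insert e₃ F))) := by
      intro e he
      simp only [mem_insert] at he
      rcases he with rfl | rfl | rfl | he
      · exact hE1.endpoints_mem (mem_insert_self _ _) (mem_insert_of_mem h₁)
      · exact hE2.endpoints_mem (mem_insert_self _ _) (mem_insert_of_mem h₂)
      · exact hE3.endpoints_mem (mem_insert_self _ _) (mem_insert_of_mem h₃)
      · exact ⟨mem_insert_of_mem (hF e he).1, mem_insert_of_mem (hF e he).2⟩
    have hle := hsub _ _ hext (insert_nonempty _ _)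
    rw [card_insert_of_notMem h₀,
      card_insert_of_notMem (by simp [he12, he13, hE1.notMem hF h₀]),
      card_insert_of_notMem (by simp [he23, hE2.notMem hF h₀]),
      card_insert_of_notMem (hE3.notMem hF h₀)] at hle
    push_cast at hle
    omega
  refine ⟨fun W F hF hc => hthree W F hF hc.ge, ?_⟩
  rintro ⟨W₁, W₂, F₁, F₂, hF₁, hc₁, h₀₁, hF₂, hc₂, h₀₂, hpairs⟩
  have hne : (W₁ ∩ W₂).Nonempty := by
    rcases hpairs with ⟨-, h₁, h₂, -⟩ | ⟨h₁, -, -, h₂⟩ | ⟨-, h₁, h₂, -⟩ <;>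
      exact ⟨_, mem_inter.2 ⟨h₁, h₂⟩⟩
  refine hthree _ _ (hF₁.union hF₂)
    (two_mul_card_union_sub_two_le hsub hF₁ hF₂ hc₁ hc₂ hne) (by simp [h₀₁, h₀₂]) ?_
  simp only [mem_union]
  tauto

end PeriodicRigidity
end

section
/- At most two constructive failures. Let ⟨G,m⟩ be a gain graph such that |E| = 2|V| − 2, every subgraph (V',E') with V' nonempty satisfies |E'| ≤ 2|V'| − 2, and m is constructive; let v₀ be a 3-valent vertex with pairwise distinct neighbours v₁, v₂, v₃ and gains m₀₁, m₀₂, m₀₃. Then there do not exist three subgraphs (V₁₂,E₁₂), (V₂₃,E₂₃), (V₃₁,E₃₁) such that for each pair (i,j) ∈ {(1,2),(2,3),(3,1)}: v_i, v_j ∈ V_{ij}, v₀ ∉ V_{ij}, |E_{ij}| = 2|V_{ij}| − 3, and (V_{ij},E_{ij}) admits a potential φ_{ij} : V_{ij} → ℤ² satisfying m(e) = φ_{ij}(h(e)) − φ_{ij}(t(e)) for every e ∈ E_{ij} together with φ_{ij}(v_j) − φ_{ij}(v_i) = m₀ⱼ − m₀ᵢ (the latter condition encodes that every path in (V_{ij},E_{ij})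 from v_i to v_j has net gain m₀ⱼ − m₀ᵢ). -/
open Finset

namespace PeriodicRigidity

variable {V E : Type*}

section Gluing

variable {t h : E → V} {m : E → ℤ × ℤ}

/-- `φ` realizes the gains on the edge set `F`. -/
def IsPotential (t h : E → V) (m : E → ℤ × ℤ) (F : Finset E) (φ : V → ℤ × ℤ) : Prop :=
  ∀ e ∈ F, m e = φ (h e) - φ (t e)

/-- Every subgraph on a nonempty vertex set `X` has at most `2 |X| - 2` edges. -/
def Sparse (t h : E → V) : Prop :=
  ∀ (X : Finset V) (F : Finset E), IsSubgraph t h X F → X.Nonempty →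
    (F.card : ℤ) ≤ 2 * X.card - 2

theorem IsSubgraph.union_s16 [DecidableEq V] [DecidableEq E] {X Y : Finset V} {F G : Finset E} (hF : IsSubgraph t h X F)
    (hG : IsSubgraph t h Y G) : IsSubgraph t h (X ∪ Y) (F ∪ G) := by
  intro e he
  rcases mem_union.1 he with he | he
  · exact ⟨mem_union_left _ (hF e he).1, mem_union_left _ (hF e he).2⟩
  · exact ⟨mem_union_right _ (hG e he).1, mem_union_right _ (hG e he).2⟩

theorem IsSubgraph.inter [DecidableEq V] [DecidableEq E] {X Y : Finset V} {F G : Finset E} (hF : IsSubgraph t h X F)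
    (hG : IsSubgraph t h Y G) : IsSubgraph t h (X ∩ Y) (F ∩ G) := by
  intro e he
  obtain ⟨h1, h2⟩ := mem_inter.1 he
  exact ⟨mem_inter.2 ⟨(hF e h1).1, (hG e h2).1⟩, mem_inter.2 ⟨(hF e h1).2, (hG e h2).2⟩⟩

theorem IsPotential.sub_const {F : Finset E} {φ : V → ℤ × ℤ} (hφ : IsPotential t h m F φ)
    (c : ℤ × ℤ) : IsPotential t h m F (fun v => φ v - c) := by
  intro e he
  rw [hφ e he, sub_sub_sub_cancel_right]

theorem IsPotential.glue [DecidableEq V] [DecidableEq E] {X Y : Finset V} {F G : Finset E} {φ ψ : V → ℤ × ℤ}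
    (hF : IsSubgraph t h X F) (hG : IsSubgraph t h Y G) (hφ : IsPotential t h m F φ)
    (hψ : IsPotential t h m G ψ) (hag : ∀ v ∈ X ∩ Y, φ v = ψ v) :
    ∃ χ, IsPotential t h m (F ∪ G) χ ∧ (∀ v ∈ X, χ v = φ v) ∧ ∀ v ∈ Y, χ v = ψ v := by
  have hX : ∀ v ∈ X, (if v ∈ X then φ v else ψ v) = φ v := by
    intro v hv
    simp [hv]
  have hY : ∀ v ∈ Y, (if v ∈ X then φ v else ψ v) = ψ v := by
    intro v hv
    by_cases hv' : v ∈ X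
    · simpa [hv'] using hag v (mem_inter.2 ⟨hv', hv⟩)
    · simp [hv']
  refine ⟨fun v => if v ∈ X then φ v else ψ v, fun e he => ?_, hX, hY⟩
  beta_reduce
  rcases mem_union.1 he with he | he
  · rw [hX _ (hF e he).1, hX _ (hF e he).2, hφ e he]
  · rw [hY _ (hG e he).1, hY _ (hG e he).2, hψ e he]

/-- Two potentials of a subgraph with at least `2 |X| - 3` edges that agree at one vertex agree
everywhere. -/
theorem Sparse.potential_unique (hs : Sparse t h) {X : Finset V} {F : Finset E}
    {φ ψ : V → ℤ × ℤ} (hF : IsSubgraph t h X F) (hcard : 2 * (X.card : ℤ) - 3 ≤ F.card)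
    (hφ : IsPotential t h m F φ) (hψ : IsPotential t h m F ψ) {c : V} (hc : c ∈ X)
    (hφψ : φ c = ψ c) : ∀ v ∈ X, φ v = ψ v := by
  by_contra! hne
  obtain ⟨b, hb, hbne⟩ := hne
  have key : ∀ e ∈ F, (φ (t e) = ψ (t e) ↔ φ (h e) = ψ (h e)) := by
    intro e he
    have h0 : φ (h e) - φ (t e) = ψ (h e) - ψ (t e) := (hφ e he).symm.trans (hψ e he)
    constructor
    · intro h1
      rw [h1] at h0
      exact sub_left_injective h0
    · intro h1
      rw [h1] at h0
      exact sub_right_injective h0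
  have h1 := hs (X.filter fun v => φ v = ψ v) (F.filter fun e => φ (t e) = ψ (t e))
    (fun e he => by
      obtain ⟨he, h1⟩ := mem_filter.1 he
      exact ⟨mem_filter.2 ⟨(hF e he).1, h1⟩, mem_filter.2 ⟨(hF e he).2, (key e he).1 h1⟩⟩)
    ⟨c, mem_filter.2 ⟨hc, hφψ⟩⟩
  have h2 := hs (X.filter fun v => ¬ φ v = ψ v) (F.filter fun e => ¬ φ (t e) = ψ (t e))
    (fun e he => by
      obtain ⟨he, h1⟩ := mem_filter.1 he
      exact ⟨mem_filter.2 ⟨(hF e he).1, h1⟩,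
        mem_filter.2 ⟨(hF e he).2, fun h2 => h1 ((key e he).2 h2)⟩⟩)
    ⟨b, mem_filter.2 ⟨hb, hbne⟩⟩
  have h3 := card_filter_add_card_filter_not (s := X) (fun v => φ v = ψ v)
  have h4 := card_filter_add_card_filter_not (s := F) (fun e => φ (t e) = ψ (t e))
  omega

theorem Sparse.disjoint_edges [DecidableEq V] [DecidableEq E] (hs : Sparse t h) {X Y : Finset V} {F G : Finset E}
    (hF : IsSubgraph t h X F) (hG : IsSubgraph t h Y G) (hXY : (X ∩ Y).card ≤ 1) :
    Disjoint F G := by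
  rw [disjoint_iff_inter_eq_empty]
  by_contra hne
  obtain ⟨e, he⟩ := nonempty_iff_ne_empty.2 hne
  have h1 := hs _ _ (hF.inter hG) ⟨t e, ((hF.inter hG) e he).1⟩
  have h2 := card_pos.2 ⟨e, he⟩
  omega

/-- If subgraphs covering `T` and avoiding `v₀` have at most `2 |X| - 3` edges, and those with
exactly `2 |X| - 3` edges have no potential extending `g` on `T`, then two balanced subgraphs with
`2 |X| - 3` edges each that together cover `T`, and whose potentials agree at a common vertex,
share only that vertex. -/
theorem Sparse.card_inter_le_one [DecidableEq V] [DecidableEq E] (hs : Sparse t h) (hcon : Constructive t h m)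
    {T : Finset V} {v₀ : V} {g : V → ℤ × ℤ}
    (hle : ∀ (X : Finset V) (F : Finset E), IsSubgraph t h X F → T ⊆ X → v₀ ∉ X →
      (F.card : ℤ) ≤ 2 * X.card - 3)
    (hne : ∀ (X : Finset V) (F : Finset E) (φ : V → ℤ × ℤ), IsSubgraph t h X F → T ⊆ X →
      v₀ ∉ X → IsPotential t h m F φ → (∀ v ∈ T, φ v = g v) → (F.card : ℤ) ≠ 2 * X.card - 3)
    {X Y : Finset V} {F G : Finset E} {φ ψ : V → ℤ × ℤ}
    (hF : IsSubgraph t h X F) (hG : IsSubgraph t h Y G) (hX : v₀ ∉ X) (hY : v₀ ∉ Y)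
    (hFc : (F.card : ℤ) = 2 * X.card - 3) (hGc : (G.card : ℤ) = 2 * Y.card - 3)
    (hφ : IsPotential t h m F φ) (hψ : IsPotential t h m G ψ)
    (hT : ∀ v ∈ T, (v ∈ X ∧ φ v = g v) ∨ (v ∈ Y ∧ ψ v = g v))
    {c : V} (hcX : c ∈ X) (hcY : c ∈ Y) (hc : φ c = ψ c) : (X ∩ Y).card ≤ 1 := by
  by_contra! hlt
  have hTU : T ⊆ X ∪ Y := fun v hv =>
    mem_union.2 ((hT v hv).imp And.left And.left)
  have h₀ : v₀ ∉ X ∪ Y := by simp [hX, hY]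
  have h1 := hle _ _ (hF.union_s16 hG) hTU h₀
  have h2 := card_union_add_card_inter X Y
  have h3 := card_union_add_card_inter F G
  have hag := hs.potential_unique (hF.inter hG) (by omega)
    (fun e he => hφ e (mem_inter.1 he).1) (fun e he => hψ e (mem_inter.1 he).2)
    (mem_inter.2 ⟨hcX, hcY⟩) hc
  obtain ⟨χ, hχ, hχX, hχY⟩ := hφ.glue hF hG hψ hag
  have h4 := hne _ _ χ (hF.union_s16 hG) hTU h₀ hχ (fun v hv => by
    rcases hT v hv with ⟨h5, h6⟩ | ⟨h5, h6⟩
    · rw [hχX v h5, h6]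
    · rw [hχY v h5, h6])
  have h5 := hs _ _ (hF.inter hG) ⟨c, mem_inter.2 ⟨hcX, hcY⟩⟩
  have h6 : ((F ∩ G).card : ℤ) ≠ 2 * (X ∩ Y).card - 2 := fun h6 =>
    hcon _ _ (hF.inter hG) hlt h6 ⟨φ, fun e he => hφ e (mem_inter.1 he).1⟩
  omega

end Gluing

/-- **At most two constructive failures.** In the usual setting (counts, subgraph
inequality, `m` constructive, `v₀` 3-valent with pairwise distinct neighbours
`v₁, v₂, v₃` and gains `m₀₁, m₀₂, m₀₃`), there do not exist three subgraphs
`(V₁₂, E₁₂), (V₂₃, E₂₃), (V₃₁, E₃₁)`, avoiding `v₀`, with `v_i, v_j ∈ V_{ij}` and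
`|E_{ij}| = 2 |V_{ij}| - 3`, each admitting a potential `φ_{ij}` realizing the gains on
`E_{ij}` and satisfying `φ_{ij} v_j - φ_{ij} v_i = m₀ⱼ - m₀ᵢ` (i.e. every path in
`(V_{ij}, E_{ij})` from `v_i` to `v_j` has net gain `m₀ⱼ - m₀ᵢ`). -/
theorem at_most_two_constructive_failures {V E : Type*} [Fintype V] [Fintype E]
    [DecidableEq V] [DecidableEq E]
    (t h : E → V) (m : E → ℤ × ℤ)
    (hE : (Fintype.card E : ℤ) = 2 * Fintype.card V - 2)
    (hsub : ∀ (V' : Finset V) (E' : Finset E), IsSubgraph t h V' E' → V'.Nonempty →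
        (E'.card : ℤ) ≤ 2 * V'.card - 2)
    (hcon : Constructive t h m)
    (v₀ v₁ v₂ v₃ : V) (m₀₁ m₀₂ m₀₃ : ℤ × ℤ) (e₁ e₂ e₃ : E)
    (he12 : e₁ ≠ e₂) (he13 : e₁ ≠ e₃) (he23 : e₂ ≠ e₃)
    (hv10 : v₁ ≠ v₀) (hv20 : v₂ ≠ v₀) (hv30 : v₃ ≠ v₀)
    (hv12 : v₁ ≠ v₂) (hv23 : v₂ ≠ v₃) (hv13 : v₁ ≠ v₃)
    (hE1 : EdgeIs t h m e₁ v₀ v₁ m₀₁)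
    (hE2 : EdgeIs t h m e₂ v₀ v₂ m₀₂)
    (hE3 : EdgeIs t h m e₃ v₀ v₃ m₀₃)
    (hval : ∀ e : E, t e = v₀ ∨ h e = v₀ → e = e₁ ∨ e = e₂ ∨ e = e₃) :
    ¬ ∃ (V₁₂ V₂₃ V₃₁ : Finset V) (E₁₂ E₂₃ E₃₁ : Finset E)
        (φ₁₂ φ₂₃ φ₃₁ : V → ℤ × ℤ),
        (IsSubgraph t h V₁₂ E₁₂ ∧ v₁ ∈ V₁₂ ∧ v₂ ∈ V₁₂ ∧ v₀ ∉ V₁₂ ∧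
          (E₁₂.card : ℤ) = 2 * V₁₂.card - 3 ∧
          (∀ e ∈ E₁₂, m e = φ₁₂ (h e) - φ₁₂ (t e)) ∧
          φ₁₂ v₂ - φ₁₂ v₁ = m₀₂ - m₀₁) ∧
        (IsSubgraph t h V₂₃ E₂₃ ∧ v₂ ∈ V₂₃ ∧ v₃ ∈ V₂₃ ∧ v₀ ∉ V₂₃ ∧
          (E₂₃.card : ℤ) = 2 * V₂₃.card - 3 ∧
          (∀ e ∈ E₂₃, m e = φ₂₃ (h e) - φ₂₃ (t e)) ∧
          φ₂₃ v₃ - φ₂₃ v₂ = m₀₃ - m₀₂) ∧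
        (IsSubgraph t h V₃₁ E₃₁ ∧ v₃ ∈ V₃₁ ∧ v₁ ∈ V₃₁ ∧ v₀ ∉ V₃₁ ∧
          (E₃₁.card : ℤ) = 2 * V₃₁.card - 3 ∧
          (∀ e ∈ E₃₁, m e = φ₃₁ (h e) - φ₃₁ (t e)) ∧
          φ₃₁ v₁ - φ₃₁ v₃ = m₀₁ - m₀₃) := by
  rintro ⟨X, Y, Z, F, G, H, φ, ψ, ω, ⟨hF, hX1, hX2, hX0, hFc, hφ, hφg⟩,
    ⟨hG, hY2, hY3, hY0, hGc, hψ, hψg⟩, ⟨hH, hZ3, hZ1, hZ0, hHc, hω, hωg⟩⟩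
  have hs : Sparse t h := hsub
  have hsubT : ∀ W : Finset V, ({v₁, v₂, v₃} : Finset V) ⊆ W → v₁ ∈ W ∧ v₂ ∈ W ∧ v₃ ∈ W := by
    intro W hW
    exact ⟨hW (by simp), hW (by simp), hW (by simp)⟩
  have hext : ∀ (W : Finset V) (K : Finset E), IsSubgraph t h W K →
      ({v₁, v₂, v₃} : Finset V) ⊆ W → v₀ ∉ W →
      IsSubgraph t h (insert v₀ W) (K ∪ {e₁, e₂, e₃}) ∧
        (K ∪ {e₁, e₂, e₃}).card = K.card + 3 := by
    intro W K hK hT h₀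
    obtain ⟨h1, h2, h3⟩ := hsubT W hT
    constructor
    · intro e he
      simp only [mem_union, mem_insert, mem_singleton] at he
      rcases he with he | rfl | rfl | rfl
      · exact ⟨mem_insert_of_mem (hK e he).1, mem_insert_of_mem (hK e he).2⟩
      · rcases hE1 with ⟨ha, hb, -⟩ | ⟨ha, hb, -⟩ <;> simp [ha, hb, h1]
      · rcases hE2 with ⟨ha, hb, -⟩ | ⟨ha, hb, -⟩ <;> simp [ha, hb, h2]
      · rcases hE3 with ⟨ha, hb, -⟩ | ⟨ha, hb, -⟩ <;> simp [ha, hb, h3]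
    · have hnot : ∀ {e : E} {v : V} {a : ℤ × ℤ}, EdgeIs t h m e v₀ v a → e ∉ K := by
        rintro e v a (⟨ha, -, -⟩ | ⟨-, ha, -⟩) he
        · exact h₀ (ha ▸ (hK e he).1)
        · exact h₀ (ha ▸ (hK e he).2)
      rw [card_union_of_disjoint, card_eq_three.2 ⟨e₁, e₂, e₃, he12, he13, he23, rfl⟩]
      simp [hnot hE1, hnot hE2, hnot hE3]
  have hle : ∀ (W : Finset V) (K : Finset E), IsSubgraph t h W K →
      ({v₁, v₂, v₃} : Finset V) ⊆ W → v₀ ∉ W → (K.card : ℤ) ≤ 2 * W.card - 3 := by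
    intro W K hK hT h₀
    obtain ⟨h1, h2⟩ := hext W K hK hT h₀
    have h3 := hsub _ _ h1 (insert_nonempty _ _)
    rw [h2, card_insert_of_notMem h₀] at h3
    push_cast at h3
    omega
  obtain ⟨g, hg1, hg2, hg3⟩ : ∃ g : V → ℤ × ℤ, g v₁ = m₀₁ ∧ g v₂ = m₀₂ ∧ g v₃ = m₀₃ :=
    ⟨fun v => if v = v₁ then m₀₁ else if v = v₂ then m₀₂ else m₀₃,
      by simp, by simp [hv12.symm], by simp [hv13.symm, hv23.symm]⟩
  have hne : ∀ (W : Finset V) (K : Finset E) (χ : V → ℤ × ℤ), IsSubgraph t h W K →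
      ({v₁, v₂, v₃} : Finset V) ⊆ W → v₀ ∉ W → IsPotential t h m K χ →
      (∀ v ∈ ({v₁, v₂, v₃} : Finset V), χ v = g v) → (K.card : ℤ) ≠ 2 * W.card - 3 := by
    intro W K χ hK hT h₀ hχ hχg hcard
    obtain ⟨h1, h2⟩ := hext W K hK hT h₀
    have hχ1 : χ v₁ = m₀₁ := (hχg v₁ (by simp)).trans hg1
    have hχ2 : χ v₂ = m₀₂ := (hχg v₂ (by simp)).trans hg2
    have hχ3 : χ v₃ = m₀₃ := (hχg v₃ (by simp)).trans hg3
    have hW : 0 < W.card := card_pos.2 ⟨v₁, (hsubT W hT).1⟩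
    have hedge : ∀ {e : E} {v : V} {a : ℤ × ℤ}, EdgeIs t h m e v₀ v a → v ≠ v₀ → χ v = a →
        m e = Function.update χ v₀ 0 (h e) - Function.update χ v₀ 0 (t e) := by
      rintro e v a (⟨ha, hb, hc⟩ | ⟨ha, hb, hc⟩) hv hχv <;>
        simp [ha, hb, hc, hv, hχv]
    refine hcon _ _ h1 ?_ ?_ ⟨Function.update χ v₀ 0, ?_⟩
    · rw [card_insert_of_notMem h₀]
      omega
    · rw [h2, card_insert_of_notMem h₀]
      push_cast
      omega
    · intro e he
      simp only [mem_union, mem_insert, mem_singleton] at he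
      rcases he with he | rfl | rfl | rfl
      · rw [Function.update_of_ne (ne_of_mem_of_not_mem (hK e he).1 h₀),
          Function.update_of_ne (ne_of_mem_of_not_mem (hK e he).2 h₀), hχ e he]
      · exact hedge hE1 hv10 hχ1
      · exact hedge hE2 hv20 hχ2
      · exact hedge hE3 hv30 hχ3
  have hnorm : ∀ {K : Finset E} {χ : V → ℤ × ℤ} {a b : V}, IsPotential t h m K χ →
      χ b - χ a = g b - g a → ∃ χ', IsPotential t h m K χ' ∧ χ' a = g a ∧ χ' b = g b := by
    intro K χ a b hχ hab
    refine ⟨_, hχ.sub_const (χ a - g a), by simp, ?_⟩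
    rw [eq_add_of_sub_eq hab]
    abel
  obtain ⟨φ', hφ', hφ1, hφ2⟩ := hnorm (a := v₁) (b := v₂) hφ (by rw [hφg, hg1, hg2])
  obtain ⟨ψ', hψ', hψ2, hψ3⟩ := hnorm (a := v₂) (b := v₃) hψ (by rw [hψg, hg2, hg3])
  obtain ⟨ω', hω', hω3, hω1⟩ := hnorm (a := v₃) (b := v₁) hω (by rw [hωg, hg3, hg1])
  have hXY : (X ∩ Y).card ≤ 1 := hs.card_inter_le_one hcon hle hne hF hG hX0 hY0 hFc hGc hφ' hψ'
    (by simp [*]) hX2 hY2 (hφ2.trans hψ2.symm)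
  have hYZ : (Y ∩ Z).card ≤ 1 := hs.card_inter_le_one hcon hle hne hG hH hY0 hZ0 hGc hHc hψ' hω'
    (by simp [*]) hY3 hZ3 (hψ3.trans hω3.symm)
  have hXZ : (X ∩ Z).card ≤ 1 := hs.card_inter_le_one hcon hle hne hF hH hX0 hZ0 hFc hHc hφ' hω'
    (by simp [*]) hX1 hZ1 (hφ1.trans hω1.symm)
  have hXY' : X ∩ Y = {v₂} := (eq_of_subset_of_card_le
    (singleton_subset_iff.2 (mem_inter.2 ⟨hX2, hY2⟩)) (by simpa using hXY)).symm
  have hYZ' : Y ∩ Z = {v₃} := (eq_of_subset_of_card_le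
    (singleton_subset_iff.2 (mem_inter.2 ⟨hY3, hZ3⟩)) (by simpa using hYZ)).symm
  have hXZ' : X ∩ Z = {v₁} := (eq_of_subset_of_card_le
    (singleton_subset_iff.2 (mem_inter.2 ⟨hX1, hZ1⟩)) (by simpa using hXZ)).symm
  have hXYZ : (X ∪ Y) ∩ Z = {v₁, v₃} := by
    rw [union_inter_distrib_right, hXZ', hYZ']
    rfl
  obtain ⟨χ, hχ, hχX, hχY⟩ := hφ'.glue hF hG hψ' (by simp [hXY', hφ2, hψ2])
  obtain ⟨ξ, hξ, hξXY, -⟩ := hχ.glue (hF.union_s16 hG) hH hω'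
    (by simp [hXYZ, hχX v₁ hX1, hχY v₃ hY3, hφ1, hψ3, hω1, hω3])
  refine hne _ _ ξ ((hF.union_s16 hG).union_s16 hH) ?_ (by simp [hX0, hY0, hZ0]) hξ ?_ ?_
  · simp [insert_subset_iff, hX1, hX2, hY3]
  · simp [hξXY, hX1, hX2, hY3, hχX, hχY, hφ1, hφ2, hψ3]
  · have h1 := card_union_add_card_inter X Y
    have h2 := card_union_add_card_inter (X ∪ Y) Z
    rw [hXY', card_singleton] at h1
    rw [hXYZ, card_pair hv13] at h2
    rw [card_union_of_disjoint (disjoint_union_left.2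
        ⟨hs.disjoint_edges hF hH hXZ, hs.disjoint_edges hG hH hYZ⟩),
      card_union_of_disjoint (hs.disjoint_edges hF hG hXY)]
    push_cast
    omega

end PeriodicRigidity
end

section
/- Reverse edge split at a 3-valent vertex with two distinct neighbours. Let ⟨G,m⟩ be a gain graph such that |E| = 2|V| − 2, every subgraph (V',E') with V' nonempty satisfies |E'| ≤ 2|V'| − 2, and m is constructive. Let v₀ ∈ V be incident to exactly three edges, none a loop: two edges from v₀ to a vertex v₁ with gains m_a and m_b where m_a ≠ m_b, and one edge from v₀ to a vertex v₂ with gain m₀₂, where v₁ ≠ v₂. Then for at least one c ∈ {m₀₂ − m_a, m₀₂ − m_b}, the gain graph obtained by deleting v₀ and its three edges and adding a single new edge from v₁ to v₂ with gain c satisfies: its edge count equals 2·(its vertex count) − 2, every subgraph with nonempty vertex set satisfies |E'| ≤ 2|V'| − 2, and its gain assignment is constructive. -/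
open Finset

namespace PeriodicRigidity

variable {V E : Type*}

/-- The edge set obtained after deleting the three edges `e₁, e₂, e₃` and adding a single
new edge (indexed by `Sum.inr ()`). -/
def splitES {E : Type*} [Fintype E] [DecidableEq E] (e₁ e₂ e₃ : E) : Finset (E ⊕ Unit) :=
  ((((univ : Finset E).erase e₁).erase e₂).erase e₃).image Sum.inl ∪ {Sum.inr ()}

theorem card_splitES_add_two [Fintype E] [DecidableEq E] {e₁ e₂ e₃ : E}
    (he12 : e₁ ≠ e₂) (he13 : e₁ ≠ e₃) (he23 : e₂ ≠ e₃) :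
    (splitES e₁ e₂ e₃).card + 2 = Fintype.card E := by
  have h3 : ({e₁, e₂, e₃} : Finset E).card = 3 := by simp [*]
  have hle : 3 ≤ Fintype.card E := h3 ▸ Finset.card_le_univ _
  rw [splitES, card_union_of_disjoint (by simp), card_image_of_injective _ Sum.inl_injective,
    card_erase_of_mem (by simp [he13.symm, he23.symm]), card_erase_of_mem (by simp [he12.symm]),
    card_erase_of_mem (mem_univ _), card_univ, card_singleton]
  omega

theorem notMem_toLeft_of_subset_splitES [Fintype E] [DecidableEq E] {e₁ e₂ e₃ : E}
    {E' : Finset (E ⊕ Unit)} (hE' : E' ⊆ splitES e₁ e₂ e₃) :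
    e₁ ∉ E'.toLeft ∧ e₂ ∉ E'.toLeft ∧ e₃ ∉ E'.toLeft := by
  refine ⟨fun he => ?_, fun he => ?_, fun he => ?_⟩ <;>
  · have := hE' (mem_toLeft.1 he)
    simp [splitES] at this

theorem card_eq_card_toLeft_of_inr_notMem {E' : Finset (E ⊕ Unit)} (hn : Sum.inr () ∉ E') :
    E'.card = E'.toLeft.card := by
  have : E'.toRight = ∅ := by
    ext ⟨⟩
    simpa using hn
  rw [← card_toLeft_add_card_toRight (u := E'), this, card_empty, add_zero]

theorem card_eq_card_toLeft_add_one_of_inr_mem {E' : Finset (E ⊕ Unit)}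
    (hn : Sum.inr () ∈ E') : E'.card = E'.toLeft.card + 1 := by
  have : E'.toRight = {()} := by
    ext ⟨⟩
    simpa using hn
  rw [← card_toLeft_add_card_toRight (u := E'), this, card_singleton]

theorem IsSubgraph.toLeft {t h : E → V} {t' h' : Unit → V} {V' : Finset V}
    {E' : Finset (E ⊕ Unit)} (hE' : IsSubgraph (Sum.elim t t') (Sum.elim h h') V' E') :
    IsSubgraph t h V' E'.toLeft :=
  fun e he => hE' (Sum.inl e) (mem_toLeft.1 he)

theorem EdgeIs.mem {t h : E → V} {m : E → ℤ × ℤ} {e : E} {u v : V} {g : ℤ × ℤ}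
    (he : EdgeIs t h m e u v g) {V' : Finset V} (hu : u ∈ V') (hv : v ∈ V') :
    t e ∈ V' ∧ h e ∈ V' := by
  obtain ⟨rfl, rfl, -⟩ | ⟨rfl, rfl, -⟩ := he
  exacts [⟨hu, hv⟩, ⟨hv, hu⟩]

/-- Adding a vertex with three edges into `V'` shows that `V'` spans one edge less than the
sparsity bound. -/
theorem card_add_three_le_of_three_edges [DecidableEq V] [DecidableEq E] {t h : E → V}
    (hsub : ∀ (V' : Finset V) (E' : Finset E), IsSubgraph t h V' E' → V'.Nonempty →
      (E'.card : ℤ) ≤ 2 * V'.card - 2)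
    {v₀ : V} {e₁ e₂ e₃ : E} (he12 : e₁ ≠ e₂) (he13 : e₁ ≠ e₃) (he23 : e₂ ≠ e₃)
    {V' : Finset V} {A : Finset E} (h0 : v₀ ∉ V')
    (hA : e₁ ∉ A ∧ e₂ ∉ A ∧ e₃ ∉ A) (hVA : IsSubgraph t h V' A)
    (hE1 : t e₁ ∈ insert v₀ V' ∧ h e₁ ∈ insert v₀ V')
    (hE2 : t e₂ ∈ insert v₀ V' ∧ h e₂ ∈ insert v₀ V')
    (hE3 : t e₃ ∈ insert v₀ V' ∧ h e₃ ∈ insert v₀ V') :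
    A.card + 3 ≤ 2 * V'.card := by
  obtain ⟨h1, h2, h3⟩ := hA
  have key := hsub (insert v₀ V') (insert e₁ (insert e₂ (insert e₃ A))) ?_ (by simp)
  · rw [card_insert_of_notMem h0, card_insert_of_notMem (by simp [*]),
      card_insert_of_notMem (by simp [*]), card_insert_of_notMem h3] at key
    push_cast at key
    omega
  · intro e he
    simp only [mem_insert] at he
    obtain rfl | rfl | rfl | he := he
    · exact hE1
    · exact hE2
    · exact hE3
    · exact ⟨mem_insert_of_mem (hVA e he).1, mem_insert_of_mem (hVA e he).2⟩

/-- If a new edge with gain `c` destroys constructivity, then the old graph has a balanced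
subgraph, one edge short of being tight, whose potential has difference `c` across the ends of
the new edge. -/
theorem exists_potential_of_not_constructiveOn [Fintype V] [Fintype E] [DecidableEq V]
    [DecidableEq E] {t h : E → V} {m : E → ℤ × ℤ} (hcon : Constructive t h m)
    {v₀ v₁ v₂ : V} {e₁ e₂ e₃ : E} {c : ℤ × ℤ}
    (hc : ¬ ConstructiveOn (Sum.elim t fun _ => v₁) (Sum.elim h fun _ => v₂)
        (Sum.elim m fun _ => c) ((univ : Finset V).erase v₀) (splitES e₁ e₂ e₃)) :
    ∃ (V' : Finset V) (A : Finset E) (φ : V → ℤ × ℤ), v₀ ∉ V' ∧ v₁ ∈ V' ∧ v₂ ∈ V' ∧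
      (e₁ ∉ A ∧ e₂ ∉ A ∧ e₃ ∉ A) ∧ IsSubgraph t h V' A ∧ A.card + 3 = 2 * V'.card ∧
      (∀ e ∈ A, m e = φ (h e) - φ (t e)) ∧ c = φ v₂ - φ v₁ := by
  simp only [ConstructiveOn, not_forall, not_not] at hc
  obtain ⟨V', E', hV', hE', hs, h2, hcard, φ, hφ⟩ := hc
  have hA : ∀ e ∈ E'.toLeft, m e = φ (h e) - φ (t e) :=
    fun e he => hφ (Sum.inl e) (mem_toLeft.1 he)
  by_cases hn : Sum.inr () ∈ E'
  · have hcard' := card_eq_card_toLeft_add_one_of_inr_mem hn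
    exact ⟨V', E'.toLeft, φ, fun h0 => by simpa using hV' h0, (hs _ hn).1, (hs _ hn).2,
      notMem_toLeft_of_subset_splitES hE', hs.toLeft, by omega, hA, hφ _ hn⟩
  · rw [card_eq_card_toLeft_of_inr_notMem hn] at hcard
    exact absurd ⟨φ, hA⟩ (hcon V' _ hs.toLeft h2 hcard)

/-- In a sparse graph, a subgraph which is at most one edge short of being tight is connected:
any function which is constant along its edges is constant on its vertices. -/
theorem eq_of_constant_along_edges [DecidableEq V] {α : Type*} {t h : E → V}
    (hsub : ∀ (V' : Finset V) (E' : Finset E), IsSubgraph t h V' E' → V'.Nonempty →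
      (E'.card : ℤ) ≤ 2 * V'.card - 2)
    {V' : Finset V} {A : Finset E} (hVA : IsSubgraph t h V' A)
    (hcard : 2 * V'.card ≤ A.card + 3) {ψ : V → α} (hψ : ∀ e ∈ A, ψ (t e) = ψ (h e))
    {u v : V} (hu : u ∈ V') (hv : v ∈ V') : ψ u = ψ v := by
  classical
  by_contra hne
  have h1 := hsub (V'.filter (ψ · = ψ u)) (A.filter fun e => ψ (t e) = ψ u)
    (fun e he => by
      obtain ⟨he, hu⟩ := mem_filter.1 he
      simp [hVA e he, ← hψ e he, hu])
    ⟨u, by simp [hu]⟩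
  have h2 := hsub (V'.filter (¬ ψ · = ψ u)) (A.filter fun e => ¬ ψ (t e) = ψ u)
    (fun e he => by
      obtain ⟨he, hu⟩ := mem_filter.1 he
      simp [hVA e he, ← hψ e he, hu])
    ⟨v, by simp [hv, Ne.symm hne]⟩
  have h3 := card_filter_add_card_filter_not (s := V') (ψ · = ψ u)
  have h4 := card_filter_add_card_filter_not (s := A) (fun e => ψ (t e) = ψ u)
  omega

/-- **Reverse edge split at a 3-valent vertex with two distinct neighbours.**
Suppose `|E| = 2 |V| - 2`, all subgraphs satisfy `|E'| ≤ 2 |V'| - 2` and `m` is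
constructive, and `v₀` is incident to exactly three non-loop edges: two edges to `v₁` with
distinct gains `ma ≠ mb` and one edge to `v₂ ≠ v₁` with gain `m₀₂`. Then for at least one
`c ∈ {m₀₂ - ma, m₀₂ - mb}`, deleting `v₀` with its three edges and adding a single new
edge from `v₁` to `v₂` with gain `c` yields a gain graph satisfying the count
`|E₀| = 2 |V₀| - 2`, the subgraph inequality, and constructivity. -/
theorem reverse_split_two_neighbours {V E : Type*} [Fintype V] [Fintype E]
    [DecidableEq V] [DecidableEq E]
    (t h : E → V) (m : E → ℤ × ℤ)
    (hE : (Fintype.card E : ℤ) = 2 * Fintype.card V - 2)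
    (hsub : ∀ (V' : Finset V) (E' : Finset E), IsSubgraph t h V' E' → V'.Nonempty →
        (E'.card : ℤ) ≤ 2 * V'.card - 2)
    (hcon : Constructive t h m)
    (v₀ v₁ v₂ : V) (ma mb m₀₂ : ℤ × ℤ) (e₁ e₂ e₃ : E)
    (he12 : e₁ ≠ e₂) (he13 : e₁ ≠ e₃) (he23 : e₂ ≠ e₃)
    (hv10 : v₁ ≠ v₀) (hv20 : v₂ ≠ v₀) (hv12 : v₁ ≠ v₂)
    (hab : ma ≠ mb)
    (hE1 : EdgeIs t h m e₁ v₀ v₁ ma)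
    (hE2 : EdgeIs t h m e₂ v₀ v₁ mb)
    (hE3 : EdgeIs t h m e₃ v₀ v₂ m₀₂)
    (hval : ∀ e : E, t e = v₀ ∨ h e = v₀ → e = e₁ ∨ e = e₂ ∨ e = e₃) :
    ∃ c : ℤ × ℤ, (c = m₀₂ - ma ∨ c = m₀₂ - mb) ∧
      (((splitES e₁ e₂ e₃).card : ℤ) = 2 * ((univ : Finset V).erase v₀).card - 2) ∧
      (∀ (V' : Finset V) (E' : Finset (E ⊕ Unit)),
        V' ⊆ (univ : Finset V).erase v₀ → E' ⊆ splitES e₁ e₂ e₃ →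
        IsSubgraph (Sum.elim t fun _ => v₁) (Sum.elim h fun _ => v₂) V' E' →
        V'.Nonempty → (E'.card : ℤ) ≤ 2 * V'.card - 2) ∧
      ConstructiveOn (Sum.elim t fun _ => v₁) (Sum.elim h fun _ => v₂)
        (Sum.elim m fun _ => c) ((univ : Finset V).erase v₀) (splitES e₁ e₂ e₃) := by
  have hbound : ∀ (V' : Finset V) (A : Finset E), v₀ ∉ V' → v₁ ∈ V' → v₂ ∈ V' →
      (e₁ ∉ A ∧ e₂ ∉ A ∧ e₃ ∉ A) → IsSubgraph t h V' A → A.card + 3 ≤ 2 * V'.card :=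
    fun V' A h0 h1 h2 hA hVA =>
      card_add_three_le_of_three_edges hsub he12 he13 he23 h0 hA hVA
        (hE1.mem (mem_insert_self _ _) (mem_insert_of_mem h1))
        (hE2.mem (mem_insert_self _ _) (mem_insert_of_mem h1))
        (hE3.mem (mem_insert_self _ _) (mem_insert_of_mem h2))
  have hcount : ((splitES e₁ e₂ e₃).card : ℤ) = 2 * ((univ : Finset V).erase v₀).card - 2 := by
    have h1 := card_splitES_add_two he12 he13 he23
    have h2 := card_erase_add_one (mem_univ v₀)
    rw [card_univ] at h2
    omega
  have hsparse : ∀ (V' : Finset V) (E' : Finset (E ⊕ Unit)),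
      V' ⊆ (univ : Finset V).erase v₀ → E' ⊆ splitES e₁ e₂ e₃ →
      IsSubgraph (Sum.elim t fun _ => v₁) (Sum.elim h fun _ => v₂) V' E' →
      V'.Nonempty → (E'.card : ℤ) ≤ 2 * V'.card - 2 := by
    intro V' E' hV' hE' hs hne
    by_cases hn : Sum.inr () ∈ E'
    · have h1 := card_eq_card_toLeft_add_one_of_inr_mem hn
      have h2 := hbound V' E'.toLeft (fun h0 => by simpa using hV' h0) (hs _ hn).1 (hs _ hn).2
        (notMem_toLeft_of_subset_splitES hE') hs.toLeft
      omega
    · rw [card_eq_card_toLeft_of_inr_notMem hn]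
      exact hsub V' _ hs.toLeft hne
  by_cases hca : ConstructiveOn (Sum.elim t fun _ => v₁) (Sum.elim h fun _ => v₂)
      (Sum.elim m fun _ => m₀₂ - ma) ((univ : Finset V).erase v₀) (splitES e₁ e₂ e₃)
  · exact ⟨_, Or.inl rfl, hcount, hsparse, hca⟩
  refine ⟨_, Or.inr rfl, hcount, hsparse, ?_⟩
  by_contra hcb
  obtain ⟨Va, A, φ, ha0, ha1, ha2, haA, has, hacard, haφ, hac⟩ :=
    exists_potential_of_not_constructiveOn hcon hca
  obtain ⟨Vb, B, χ, hb0, hb1, hb2, hbB, hbs, hbcard, hbχ, hbc⟩ :=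
    exists_potential_of_not_constructiveOn hcon hcb
  have hunion := hbound (Va ∪ Vb) (A ∪ B) (by simp [ha0, hb0]) (mem_union_left _ ha1)
    (mem_union_left _ ha2) (by simp [haA, hbB]) (fun e he => by
      rcases mem_union.1 he with he | he
      · simp [has e he]
      · simp [hbs e he])
  have hV := card_union_add_card_inter Va Vb
  have hAB := card_union_add_card_inter A B
  have heq := eq_of_constant_along_edges (ψ := φ - χ) hsub (V' := Va ∩ Vb) (A := A ∩ B)
    (fun e he => by
      obtain ⟨hea, heb⟩ := mem_inter.1 he
      simp [has e hea, hbs e heb])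
    (by omega)
    (fun e he => by
      obtain ⟨hea, heb⟩ := mem_inter.1 he
      have hd := (haφ e hea).symm.trans (hbχ e heb)
      simp only [Pi.sub_apply]
      rw [← sub_eq_zero] at hd ⊢
      rw [← neg_eq_zero, ← hd]
      abel)
    (mem_inter.2 ⟨ha1, hb1⟩) (mem_inter.2 ⟨ha2, hb2⟩)
  simp only [Pi.sub_apply] at heq
  apply hab
  have : m₀₂ - ma = m₀₂ - mb := by
    rw [hac, hbc]
    rw [← sub_eq_zero] at heq ⊢
    rw [← neg_eq_zero, ← heq]
    abel
  exact sub_right_injective this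

end PeriodicRigidity
end
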